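/- (Decreasing line capacities.) Let I be a nonempty finite index set with l_i > 0, F_i > 0 for i ∈ I and Q > 0, and suppose the capacities a_i > 0 satisfy ∑_{i∈I} l_i · F_i / a_i ≤ Q and attain the minimum material cost (∑_{i∈I} l_i · √(F_i))² / Q. Then the cost-minimizing capacities are ordered like the flows: for all i, j ∈ I, if F_i ≥ F_j then a_i ≥ a_j, and if F_i > F_j then a_i > a_j. In particular, since flows decrease when moving downstream along a path, the optimal capacities decrease when moving downstream. -/

import Mathlib

open Finset

/-- Capacities that meet the voltage-drop bound at minimum cost are proportional to `√F`. -/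
theorem optimal_capacity_eq {I : Type*} [Fintype I]
    (l F a : I → ℝ) (Q : ℝ)
    (hl : ∀ i, 0 < l i) (hF : ∀ i, 0 ≤ F i) (ha : ∀ i, 0 < a i)
    (hQ : 0 < Q)
    (hdrop : ∑ i, l i * F i / a i ≤ Q)
    (hopt : ∑ i, l i * a i = (∑ i, l i * Real.sqrt (F i)) ^ 2 / Q) (i : I) :
    a i = (∑ k, l k * Real.sqrt (F k)) / Q * Real.sqrt (F i) := by
  set S := ∑ k, l k * Real.sqrt (F k) with hS
  set t := S / Q with ht
  have expand : ∑ k, l k * (a k - t * Real.sqrt (F k)) ^ 2 / a k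
      = ∑ k, l k * a k - 2 * t * S + t ^ 2 * ∑ k, l k * F k / a k := by
    rw [hS, mul_sum, mul_sum, ← sum_sub_distrib, ← sum_add_distrib]
    refine sum_congr rfl fun k _ => ?_
    have hak := (ha k).ne'
    have hsq := Real.sq_sqrt (hF k)
    field_simp
    linear_combination l k * t ^ 2 * hsq
  have nonneg : ∀ k ∈ univ, 0 ≤ l k * (a k - t * Real.sqrt (F k)) ^ 2 / a k := fun k _ =>
    div_nonneg (mul_nonneg (hl k).le (sq_nonneg _)) (ha k).le
  have sum_zero : ∑ k, l k * (a k - t * Real.sqrt (F k)) ^ 2 / a k = 0 := by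
    refine le_antisymm ?_ (sum_nonneg nonneg)
    have hbound := mul_le_mul_of_nonneg_left hdrop (sq_nonneg t)
    have hcost : S ^ 2 / Q - 2 * t * S + t ^ 2 * Q = 0 := by
      rw [ht]
      field_simp
      ring
    rw [expand, hopt]
    linarith
  have hi := (sum_eq_zero_iff_of_nonneg nonneg).1 sum_zero i (mem_univ i)
  simpa [(hl i).ne', (ha i).ne', sub_eq_zero] using hi

/-- Decreasing line capacities, Corollary 1: cost-minimizing
capacities along a path are ordered like the flows. -/
theorem optimal_capacities_monotone_in_flows
    {I : Type*} [Fintype I] [Nonempty I]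
    (l F a : I → ℝ) (Q : ℝ)
    (hl : ∀ i, 0 < l i) (hF : ∀ i, 0 < F i) (ha : ∀ i, 0 < a i)
    (hQ : 0 < Q)
    (hdrop : ∑ i, l i * F i / a i ≤ Q)
    (hopt : ∑ i, l i * a i = (∑ i, l i * Real.sqrt (F i)) ^ 2 / Q) :
    ∀ i j : I, (F j ≤ F i → a j ≤ a i) ∧ (F j < F i → a j < a i) := by
  intro i j
  have heq := optimal_capacity_eq l F a Q hl (fun k => (hF k).le) ha hQ hdrop hopt
  have hpos : 0 < (∑ k, l k * Real.sqrt (F k)) / Q :=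
    div_pos (sum_pos (fun k _ => mul_pos (hl k) (Real.sqrt_pos.2 (hF k))) univ_nonempty) hQ
  rw [heq i, heq j]
  exact ⟨fun h => mul_le_mul_of_nonneg_left (Real.sqrt_le_sqrt h) hpos.le,
    fun h => mul_lt_mul_of_pos_left (Real.sqrt_lt_sqrt (hF j).le h) hpos⟩
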